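/- Fix k ≥ 3 and let n > 2k. Then for every p ∈ [0,1], the probability P_k^t(n,p) that a random Turán k-partite graph on n vertices with edge probability p has diameter at most 2 satisfies P_k^t(n,p) ≥ 1 − (n²(1−p²)^{n(1−1/k)−1}/(2k)) · (1 + (k−1)(1−p²)^{−n/k−1}) · (1 + k/n). -/

import Mathlib

open scoped Classical

/-- The number of unordered pairs of vertices lying in two different partite sets, for a
`k`-partite vertex set with part sizes `sz 0, …, sz (k-1)`. -/
def crossPairs (k : ℕ) (sz : Fin k → ℕ) : ℕ :=
  ∑ i : Fin k, ∑ j : Fin k, if i < j then sz i * sz j else 0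

/-- The probability that a random `k`-partite graph — with partite sets of sizes
`sz 0, …, sz (k-1)`, in which each pair of vertices lying in two different partite sets
is joined by an edge independently with probability `p` — is connected with diameter at
most `2`. -/
noncomputable def kpartiteDiam2Prob (k : ℕ) (sz : Fin k → ℕ) (p : ℝ) : ℝ :=
  ∑ G : SimpleGraph (Σ i : Fin k, Fin (sz i)),
    if (∀ u v : (Σ i : Fin k, Fin (sz i)), G.Adj u v → u.1 ≠ v.1) ∧
        G.Connected ∧ ∀ u v : (Σ i : Fin k, Fin (sz i)), G.dist u v ≤ 2 then
      p ^ Nat.card G.edgeSet * (1 - p) ^ (crossPairs k sz - Nat.card G.edgeSet)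
    else 0

/-- The Turán partition of `n` vertices into `k` parts: the part sizes are as equal as
possible, each being `⌊n/k⌋` or `⌈n/k⌉`. -/
def turanSizes (k n : ℕ) : Fin k → ℕ :=
  fun i => if (i : ℕ) < n % k then n / k + 1 else n / k

/-- The probability that a random Turán `k`-partite graph on `n` vertices with edge
probability `p` is connected with diameter at most `2`. -/
noncomputable def turanKpartiteDiam2Prob (k n : ℕ) (p : ℝ) : ℝ :=
  kpartiteDiam2Prob k (turanSizes k n) p

open Finset in
theorem sum_powerset_weight_superset {α : Type*} (E A : Finset α) (hA : A ⊆ E) (p : ℝ) :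
    ∑ S ∈ E.powerset, (if A ⊆ S then p ^ #S * (1 - p) ^ (#E - #S) else 0) = p ^ #A := by
  have key := Finset.prod_add (fun _ : α => p) (fun e => if e ∈ A then 0 else 1 - p) E
  have hl : ∏ e ∈ E, (p + if e ∈ A then 0 else 1 - p) = p ^ #A := by
    have : ∀ e ∈ E, (p + if e ∈ A then 0 else 1 - p) = if e ∈ A then p else 1 := by
      intro e _
      split_ifs <;> ring
    rw [Finset.prod_congr rfl this, Finset.prod_ite, Finset.prod_const, Finset.prod_const_one,
      mul_one, Finset.filter_mem_eq_inter, Finset.inter_eq_right.mpr hA]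
  rw [← hl, key]
  refine Finset.sum_congr rfl fun S hS => ?_
  rw [Finset.mem_powerset] at hS
  rw [Finset.prod_const]
  split_ifs with h
  · congr 1
    rw [← Finset.card_sdiff_of_subset hS, ← Finset.prod_const]
    refine Finset.prod_congr rfl fun e he => ?_
    rw [if_neg fun hA' => (Finset.mem_sdiff.mp he).2 (h hA')]
  · obtain ⟨e, heA, heS⟩ := Finset.not_subset.mp h
    have h0 : ∏ e ∈ E \ S, (if e ∈ A then 0 else 1 - p) = 0 :=
      Finset.prod_eq_zero (Finset.mem_sdiff.mpr ⟨hA heA, heS⟩) (by simp [heA])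
    rw [h0, mul_zero]

open Finset in
theorem sum_powerset_weight_avoid_pairs {α ι : Type*} (E : Finset α) (W : Finset ι)
    (a b : ι → α) (haE : ∀ w ∈ W, a w ∈ E) (hbE : ∀ w ∈ W, b w ∈ E)
    (ha : Set.InjOn a W) (hb : Set.InjOn b W) (hab : ∀ w ∈ W, ∀ w' ∈ W, a w ≠ b w') (p : ℝ) :
    ∑ S ∈ E.powerset,
      (if ∀ w ∈ W, ¬(a w ∈ S ∧ b w ∈ S) then p ^ #S * (1 - p) ^ (#E - #S) else 0) =
      (1 - p ^ 2) ^ #W := by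
  have expand : ∀ S : Finset α,
      (if ∀ w ∈ W, ¬(a w ∈ S ∧ b w ∈ S) then p ^ #S * (1 - p) ^ (#E - #S) else 0) =
        ∑ T ∈ W.powerset, (-1 : ℝ) ^ #T *
          (if T.image a ∪ T.image b ⊆ S then p ^ #S * (1 - p) ^ (#E - #S) else 0) := by
    intro S
    have h1 : ∏ w ∈ W, ((if a w ∈ S ∧ b w ∈ S then (-1 : ℝ) else 0) + 1) =
        if ∀ w ∈ W, ¬(a w ∈ S ∧ b w ∈ S) then 1 else 0 := by
      split_ifs with h
      · refine Finset.prod_eq_one fun w hw => ?_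
        rw [if_neg (h w hw), zero_add]
      · push Not at h
        obtain ⟨w, hw, h⟩ := h
        exact Finset.prod_eq_zero hw (by rw [if_pos h]; norm_num)
    have h2 : ∀ T : Finset ι, ∏ w ∈ T, (if a w ∈ S ∧ b w ∈ S then (-1 : ℝ) else 0) =
        if T.image a ∪ T.image b ⊆ S then (-1 : ℝ) ^ #T else 0 := by
      intro T
      have hiff : T.image a ∪ T.image b ⊆ S ↔ ∀ w ∈ T, a w ∈ S ∧ b w ∈ S := by
        rw [Finset.union_subset_iff, Finset.image_subset_iff, Finset.image_subset_iff]
        exact ⟨fun h w hw => ⟨h.1 w hw, h.2 w hw⟩, fun h =>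
          ⟨fun w hw => (h w hw).1, fun w hw => (h w hw).2⟩⟩
      split_ifs with h
      · rw [← Finset.prod_const]
        exact Finset.prod_congr rfl fun w hw => if_pos (hiff.mp h w hw)
      · rw [hiff] at h
        push Not at h
        obtain ⟨w, hw, h⟩ := h
        exact Finset.prod_eq_zero hw (if_neg fun h' => h h'.1 h'.2)
    rw [Finset.prod_add_one] at h1
    have h3 : (if ∀ w ∈ W, ¬(a w ∈ S ∧ b w ∈ S) then p ^ #S * (1 - p) ^ (#E - #S) else 0) =
        (if ∀ w ∈ W, ¬(a w ∈ S ∧ b w ∈ S) then 1 else 0) * (p ^ #S * (1 - p) ^ (#E - #S)) := by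
      split_ifs <;> simp
    rw [h3, ← h1, Finset.sum_mul]
    refine Finset.sum_congr rfl fun T _ => ?_
    rw [h2 T]
    split_ifs <;> simp
  rw [Finset.sum_congr rfl fun S _ => expand S, Finset.sum_comm]
  have hT : ∀ T ∈ W.powerset, ∑ S ∈ E.powerset, (-1 : ℝ) ^ #T *
      (if T.image a ∪ T.image b ⊆ S then p ^ #S * (1 - p) ^ (#E - #S) else 0) =
      ∏ _w ∈ T, (-p ^ 2) := by
    intro T hT
    rw [Finset.mem_powerset] at hT
    rw [← Finset.mul_sum, sum_powerset_weight_superset, Finset.card_union_of_disjoint,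
      Finset.card_image_of_injOn, Finset.card_image_of_injOn, Finset.prod_const, neg_pow (p ^ 2)]
    · ring
    · exact hb.mono (by exact_mod_cast hT)
    · exact ha.mono (by exact_mod_cast hT)
    · rw [Finset.disjoint_left]
      intro e he he'
      obtain ⟨w, hw, rfl⟩ := Finset.mem_image.mp he
      obtain ⟨w', hw', h⟩ := Finset.mem_image.mp he'
      exact hab w (hT hw) w' (hT hw') h.symm
    · rw [Finset.union_subset_iff, Finset.image_subset_iff, Finset.image_subset_iff]
      exact ⟨fun w hw => haE w (hT hw), fun w hw => hbE w (hT hw)⟩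
  rw [Finset.sum_congr rfl hT, ← Finset.prod_add_one, Finset.prod_const]
  congr 1
  ring

/-- Sums over the spanning subgraphs of `H` are sums over the subsets of its edge set. -/
theorem SimpleGraph.sum_le_eq_sum_powerset_edgeFinset {V : Type*}
    [Fintype (SimpleGraph V)] [∀ G : SimpleGraph V, Fintype G.edgeSet] (H : SimpleGraph V)
    [∀ G : SimpleGraph V, Decidable (G ≤ H)] (f : Finset (Sym2 V) → ℝ) :
    ∑ G : SimpleGraph V, (if G ≤ H then f G.edgeFinset else 0) =
      ∑ S ∈ H.edgeFinset.powerset, f S := by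
  rw [← Finset.sum_filter]
  have hS : ∀ S ∈ H.edgeFinset.powerset,
      (SimpleGraph.fromEdgeSet (S : Set (Sym2 V))).edgeFinset = S := by
    intro S hS
    rw [Finset.mem_powerset] at hS
    ext e
    rw [SimpleGraph.mem_edgeFinset, SimpleGraph.edgeSet_fromEdgeSet]
    refine ⟨fun h => h.1, fun h => ⟨h, ?_⟩⟩
    exact H.not_isDiag_of_mem_edgeSet (SimpleGraph.mem_edgeFinset.mp (hS h))
  refine Finset.sum_bij' (fun G _ => G.edgeFinset)
    (fun S _ => SimpleGraph.fromEdgeSet (S : Set (Sym2 V))) ?_ ?_ ?_ ?_ ?_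
  · intro G hG
    rw [Finset.mem_powerset, SimpleGraph.edgeFinset_subset_edgeFinset]
    exact (Finset.mem_filter.mp hG).2
  · intro S hS'
    rw [Finset.mem_filter, ← SimpleGraph.edgeFinset_subset_edgeFinset, hS S hS']
    exact ⟨Finset.mem_univ _, Finset.mem_powerset.mp hS'⟩
  · intro G _
    rw [SimpleGraph.coe_edgeFinset, SimpleGraph.fromEdgeSet_edgeSet]
  · intro S hS'
    convert hS S hS'
  · intro G _
    rfl

/-- A graph in which any two distinct vertices have a common neighbor is connected with
diameter at most two. -/
theorem SimpleGraph.connected_and_dist_le_two {V : Type*} [Nonempty V] (G : SimpleGraph V)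
    (h : ∀ u v, u ≠ v → ∃ w, G.Adj u w ∧ G.Adj v w) :
    G.Connected ∧ ∀ u v, G.dist u v ≤ 2 := by
  have hw : ∀ u v, ∃ q : G.Walk u v, q.length ≤ 2 := by
    intro u v
    by_cases huv : u = v
    · subst huv
      exact ⟨.nil, by simp⟩
    · obtain ⟨w, h1, h2⟩ := h u v huv
      exact ⟨.cons h1 (.cons h2.symm .nil), by simp⟩
  refine ⟨⟨fun u v => ?_⟩, fun u v => ?_⟩
  · obtain ⟨q, -⟩ := hw u v
    exact ⟨q⟩
  · obtain ⟨q, hq⟩ := hw u v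
    exact (SimpleGraph.dist_le q).trans hq

theorem card_sigma_fst_eq {k : ℕ} (sz : Fin k → ℕ) (i : Fin k) :
    (Finset.univ.filter fun w : (Σ i : Fin k, Fin (sz i)) => w.1 = i).card = sz i := by
  let f : Fin k → ℕ := fun j => if j = i then 1 else 0
  have h : ∑ w : (Σ i : Fin k, Fin (sz i)), f w.1 = sz i := by
    rw [Fintype.sum_sigma]
    simp [f]
  rw [Finset.card_filter, ← h]

theorem two_mul_crossPairs (k : ℕ) (sz : Fin k → ℕ) :
    2 * crossPairs k sz = ∑ i, ∑ j, if i ≠ j then sz i * sz j else 0 := by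
  have h : crossPairs k sz = ∑ i : Fin k, ∑ j : Fin k, if j < i then sz i * sz j else 0 := by
    rw [crossPairs, Finset.sum_comm]
    simp only [mul_comm]
  rw [two_mul]
  nth_rewrite 2 [h]
  rw [crossPairs, ← Finset.sum_add_distrib]
  refine Finset.sum_congr rfl fun i _ => ?_
  rw [← Finset.sum_add_distrib]
  refine Finset.sum_congr rfl fun j _ => ?_
  rcases lt_trichotomy i j with h | h | h
  · simp [h, h.ne, h.not_gt]
  · simp [h]
  · simp [h, h.ne', h.not_gt]

theorem card_edgeFinset_completeMultipartiteGraph_fin (k : ℕ) (sz : Fin k → ℕ) :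
    (SimpleGraph.completeMultipartiteGraph fun i => Fin (sz i)).edgeFinset.card =
      crossPairs k sz := by
  have h := SimpleGraph.sum_degrees_eq_twice_card_edges
    (SimpleGraph.completeMultipartiteGraph fun i => Fin (sz i))
  have h2 := two_mul_crossPairs k sz
  let d : Fin k → ℕ := fun i => ∑ j, if i ≠ j then sz j else 0
  have hd : ∀ u : (Σ i, Fin (sz i)),
      (SimpleGraph.completeMultipartiteGraph fun i => Fin (sz i)).degree u = d u.1 := by
    intro u
    rw [← SimpleGraph.card_neighborFinset_eq_degree, SimpleGraph.neighborFinset_eq_filter,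
      Finset.card_filter, Fintype.sum_sigma]
    refine Finset.sum_congr rfl fun j _ => ?_
    by_cases hj : u.1 = j <;> simp [SimpleGraph.completeMultipartiteGraph, hj]
  rw [Finset.sum_congr rfl fun u _ => hd u, Fintype.sum_sigma] at h
  simp only [d, Finset.sum_const, Finset.card_univ, Fintype.card_fin, smul_eq_mul,
    Finset.mul_sum, mul_ite, mul_zero] at h
  omega

/-- Union bound over ordered pairs of distinct vertices without a common neighbor. -/
theorem one_sub_sum_le_kpartiteDiam2Prob (k : ℕ) (sz : Fin k → ℕ)
    [Nonempty (Σ i : Fin k, Fin (sz i))] (p : ℝ) (hp0 : 0 ≤ p) (hp1 : p ≤ 1) :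
    1 - (∑ u : (Σ i : Fin k, Fin (sz i)), ∑ v : (Σ i : Fin k, Fin (sz i)),
      if u = v then 0 else
        (1 - p ^ 2) ^ (Finset.univ.filter fun w : (Σ i : Fin k, Fin (sz i)) =>
          w.1 ≠ u.1 ∧ w.1 ≠ v.1).card) / 2 ≤ kpartiteDiam2Prob k sz p := by
  obtain ⟨H, hAdj, hHcard⟩ : ∃ H : SimpleGraph (Σ i : Fin k, Fin (sz i)),
      (∀ u v, H.Adj u v ↔ u.1 ≠ v.1) ∧ H.edgeFinset.card = crossPairs k sz := by
    refine ⟨SimpleGraph.completeMultipartiteGraph fun i => Fin (sz i), fun u v => Iff.rfl, ?_⟩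
    convert card_edgeFinset_completeMultipartiteGraph_fin k sz
  let W : (Σ i : Fin k, Fin (sz i)) → (Σ i : Fin k, Fin (sz i)) →
    Finset (Σ i : Fin k, Fin (sz i)) := fun u v =>
      Finset.univ.filter fun w => w.1 ≠ u.1 ∧ w.1 ≠ v.1
  let wt : Finset (Sym2 (Σ i : Fin k, Fin (sz i))) → ℝ := fun S =>
    p ^ S.card * (1 - p) ^ (H.edgeFinset.card - S.card)
  let bad : (Σ i : Fin k, Fin (sz i)) → (Σ i : Fin k, Fin (sz i)) →
    Finset (Sym2 (Σ i : Fin k, Fin (sz i))) → Prop := fun u v S =>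
      ∀ w ∈ W u v, ¬(s(u, w) ∈ S ∧ s(v, w) ∈ S)
  have hwt : ∀ S, 0 ≤ wt S := fun S =>
    mul_nonneg (pow_nonneg hp0 _) (pow_nonneg (by linarith) _)
  have htotal : ∑ S ∈ H.edgeFinset.powerset, wt S = 1 := by
    have := sum_powerset_weight_superset H.edgeFinset ∅ (Finset.empty_subset _) p
    simpa [wt] using this
  have hbad : ∀ u v, u ≠ v → ∑ S ∈ H.edgeFinset.powerset, (if bad u v S then wt S else 0) =
      (1 - p ^ 2) ^ (W u v).card := by
    intro u v huv
    convert sum_powerset_weight_avoid_pairs H.edgeFinset (W u v) (fun w => s(u, w))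
      (fun w => s(v, w)) ?_ ?_ ?_ ?_ ?_ p
    · intro w hw
      simpa [hAdj] using (Finset.mem_filter.mp hw).2.1.symm
    · intro w hw
      simpa [hAdj] using (Finset.mem_filter.mp hw).2.2.symm
    · intro w _ w' _ h
      exact Sym2.congr_right.mp h
    · intro w _ w' _ h
      exact Sym2.congr_right.mp h
    · intro w _ w' hw' h
      rcases Sym2.eq_iff.mp h with h | h
      · exact huv h.1
      · exact (Finset.mem_filter.mp hw').2.1 (congrArg Sigma.fst h.1.symm)
  have hpoint : ∀ G : SimpleGraph (Σ i : Fin k, Fin (sz i)),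
      (if G ≤ H then wt G.edgeFinset - (∑ u, ∑ v, if u = v then 0 else
        if bad u v G.edgeFinset then wt G.edgeFinset else 0) / 2 else 0) ≤
      if (∀ u v : (Σ i : Fin k, Fin (sz i)), G.Adj u v → u.1 ≠ v.1) ∧
        G.Connected ∧ ∀ u v : (Σ i : Fin k, Fin (sz i)), G.dist u v ≤ 2 then
      p ^ Nat.card G.edgeSet * (1 - p) ^ (crossPairs k sz - Nat.card G.edgeSet)
      else 0 := by
    intro G
    have hcard : p ^ Nat.card G.edgeSet * (1 - p) ^ (crossPairs k sz - Nat.card G.edgeSet) =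
        wt G.edgeFinset := by
      simp only [wt]
      rw [hHcard, Nat.card_eq_fintype_card,
        SimpleGraph.edgeFinset_card]
    have hle : (∀ u v, G.Adj u v → u.1 ≠ v.1) ↔ G ≤ H :=
      ⟨fun h u v huv => (hAdj u v).mpr (h u v huv), fun h u v huv => (hAdj u v).mp (h huv)⟩
    rw [hcard]
    have hterm : ∀ u v : (Σ i : Fin k, Fin (sz i)), (0 : ℝ) ≤ if u = v then 0 else
        if bad u v G.edgeFinset then wt G.edgeFinset else 0 := by
      intro u v
      split_ifs
      exacts [le_rfl, hwt _, le_rfl]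
    by_cases hG : G ≤ H
    · rw [if_pos hG]
      by_cases hc : G.Connected ∧ ∀ u v, G.dist u v ≤ 2
      · rw [if_pos ⟨hle.mpr hG, hc⟩]
        have := Finset.sum_nonneg fun u (_ : u ∈ Finset.univ) =>
          Finset.sum_nonneg fun v (_ : v ∈ Finset.univ) => hterm u v
        linarith
      · rw [if_neg fun h => hc h.2]
        have hex : ∃ u v, u ≠ v ∧ ∀ w, ¬(G.Adj u w ∧ G.Adj v w) := by
          by_contra! hcon
          exact hc (G.connected_and_dist_le_two hcon)
        obtain ⟨u, v, huv, hno⟩ := hex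
        have huv_bad : bad u v G.edgeFinset := fun w _ h =>
          hno w ⟨by simpa using h.1, by simpa using h.2⟩
        have hvu_bad : bad v u G.edgeFinset := fun w _ h =>
          hno w ⟨by simpa using h.2, by simpa using h.1⟩
        have hrow : ∀ x y, x ≠ y → bad x y G.edgeFinset → wt G.edgeFinset ≤
            ∑ y, if x = y then 0 else
              if bad x y G.edgeFinset then wt G.edgeFinset else 0 := by
          intro x y hxy hb
          refine le_trans ?_ (Finset.single_le_sum (fun y _ => hterm x y) (Finset.mem_univ y))
          rw [if_neg hxy, if_pos hb]
        have h2 := Finset.add_le_sum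
          (fun x _ => Finset.sum_nonneg fun y (_ : y ∈ Finset.univ) => hterm x y)
          (Finset.mem_univ u) (Finset.mem_univ v) huv
        linarith [hrow u v huv huv_bad, hrow v u huv.symm hvu_bad]
    · rw [if_neg hG, if_neg fun h => hG (hle.mp h.1)]
  refine le_trans (le_of_eq ?_) (Finset.sum_le_sum fun G _ => hpoint G)
  have hsubsets := H.sum_le_eq_sum_powerset_edgeFinset fun S =>
    wt S - (∑ u, ∑ v, if u = v then 0 else if bad u v S then wt S else 0) / 2
  refine Eq.trans ?_ hsubsets.symm
  rw [Finset.sum_sub_distrib, htotal, ← Finset.sum_div,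
    Finset.sum_comm (s := H.edgeFinset.powerset)]
  congr 2
  refine Finset.sum_congr rfl fun u _ => ?_
  rw [Finset.sum_comm]
  refine Finset.sum_congr rfl fun v _ => ?_
  by_cases huv : u = v
  · simp [huv]
  · simp only [if_neg huv]
    exact (hbad u v huv).symm

theorem sum_turanSizes (k n : ℕ) (hk : 0 < k) : ∑ i, turanSizes k n i = n := by
  have h : ∀ i : Fin k, turanSizes k n i = n / k + if (i : ℕ) < n % k then 1 else 0 := by
    intro i
    rw [turanSizes]
    split_ifs <;> rfl
  rw [Finset.sum_congr rfl fun i _ => h i, Finset.sum_add_distrib,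
    Fin.sum_univ_eq_sum_range (fun i => if i < n % k then 1 else 0) k, ← Finset.card_filter]
  have hf : (Finset.range k).filter (fun i => i < n % k) = Finset.range (n % k) := by
    ext i
    have := Nat.mod_lt n hk
    simp only [Finset.mem_filter, Finset.mem_range]
    omega
  rw [hf, Finset.card_range]
  simp [Nat.div_add_mod]

theorem turanSizes_le (k n : ℕ) (i : Fin k) :
    (turanSizes k n i : ℝ) ≤ (n : ℝ) / k + 1 := by
  have h : turanSizes k n i ≤ n / k + 1 := by
    rw [turanSizes]
    split_ifs <;> omega
  have h' : (turanSizes k n i : ℝ) ≤ ((n / k : ℕ) : ℝ) + 1 := by exact_mod_cast h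
  linarith [@Nat.cast_div_le ℝ _ _ _ n k]

/-- Simple-sieve lower bound for random Turán `k`-partite graphs having diameter at
most 2. Real powers of `1 - p²` are used for the real exponents. -/
theorem turanKpartiteDiam2Prob_lower (k : ℕ) (hk : 3 ≤ k) (n : ℕ) (hn : 2 * k < n)
    (p : ℝ) (hp0 : 0 ≤ p) (hp1 : p ≤ 1) :
    1 - ((n : ℝ) ^ 2 * (1 - p ^ 2) ^ ((n : ℝ) * (1 - 1 / (k : ℝ)) - 1) / (2 * (k : ℝ))) *
        (1 + ((k : ℝ) - 1) * (1 - p ^ 2) ^ (-((n : ℝ) / (k : ℝ)) - 1)) *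
        (1 + (k : ℝ) / (n : ℝ)) ≤
      turanKpartiteDiam2Prob k n p := by
  have hkR : (3 : ℝ) ≤ k := by exact_mod_cast hk
  have hk0 : (0 : ℝ) < k := by linarith
  have hnR : 2 * (k : ℝ) < n := by exact_mod_cast hn
  have hn0 : (0 : ℝ) < n := by linarith
  set sz := turanSizes k n with hsz
  have hsum : ∑ i, sz i = n := sum_turanSizes k n (by omega)
  have hsumR : ∑ i, (sz i : ℝ) = n := by exact_mod_cast hsum
  have hcard : Fintype.card (Σ i : Fin k, Fin (sz i)) = n := by simp [hsum]
  have hne : Nonempty (Σ i : Fin k, Fin (sz i)) := Fintype.card_pos_iff.mp (by omega)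
  have hszle : ∀ i, (sz i : ℝ) ≤ (n : ℝ) / k + 1 := turanSizes_le k n
  refine le_trans ?_ (one_sub_sum_le_kpartiteDiam2Prob k sz p hp0 hp1)
  set q := 1 - p ^ 2 with hq
  have hq0 : 0 ≤ q := by nlinarith
  have hq1 : q ≤ 1 := by nlinarith
  set x := (n : ℝ) / k with hx
  have hx2 : 2 < x := by rw [hx, lt_div_iff₀ hk0]; exact hnR
  have hnx : (n : ℝ) = k * x := by rw [hx]; field_simp
  have hα : (n : ℝ) * (1 - 1 / (k : ℝ)) - 1 = n - x - 1 := by rw [hx]; ring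
  have hβ : 0 < (n - x - 1) + (-x - 1) := by rw [hnx]; nlinarith
  set A := q ^ ((n : ℝ) - x - 1) with hA
  set B := q ^ ((n : ℝ) - x - 1 + (-x - 1)) with hB
  have hA0 : 0 ≤ A := Real.rpow_nonneg hq0 _
  have hB0 : 0 ≤ B := Real.rpow_nonneg hq0 _
  have hAB : B = A * q ^ (-x - 1) := Real.rpow_add' hq0 hβ.ne'
  have hWcard : ∀ u v : (Σ i : Fin k, Fin (sz i)), (n : ℝ) =
      (Finset.univ.filter fun w : (Σ i : Fin k, Fin (sz i)) => w.1 ≠ u.1 ∧ w.1 ≠ v.1).card +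
      (Finset.univ.filter fun w : (Σ i : Fin k, Fin (sz i)) => w.1 = u.1 ∨ w.1 = v.1).card := by
    intro u v
    have := Finset.card_filter_add_card_filter_not (s := Finset.univ)
      (fun w : (Σ i : Fin k, Fin (sz i)) => w.1 ≠ u.1 ∧ w.1 ≠ v.1)
    rw [Finset.card_univ, hcard] at this
    simp only [not_and_or, not_not] at this
    exact_mod_cast this.symm
  have hterm : ∀ u v : (Σ i : Fin k, Fin (sz i)), (if u = v then 0 else
      q ^ (Finset.univ.filter fun w : (Σ i : Fin k, Fin (sz i)) =>
          w.1 ≠ u.1 ∧ w.1 ≠ v.1).card) ≤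
      (if v.1 = u.1 then A else B) - if u = v then A else 0 := by
    intro u v
    have hW := hWcard u v
    by_cases huv : u = v
    · simp [huv]
    rw [if_neg huv, if_neg huv, sub_zero]
    rw [← Real.rpow_natCast]
    split_ifs with h
    · refine Real.rpow_le_rpow_of_exponent_ge' hq0 hq1 (by linarith) ?_
      simp only [h, or_self] at hW ⊢
      rw [card_sigma_fst_eq] at hW
      linarith [hszle u.1]
    · refine Real.rpow_le_rpow_of_exponent_ge' hq0 hq1 hβ.le ?_
      rw [Finset.filter_or] at hW
      have hu := Finset.card_union_le
        (Finset.univ.filter fun w : (Σ i : Fin k, Fin (sz i)) => w.1 = u.1)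
        (Finset.univ.filter fun w : (Σ i : Fin k, Fin (sz i)) => w.1 = v.1)
      rw [card_sigma_fst_eq, card_sigma_fst_eq] at hu
      have hu' := (Nat.cast_le (α := ℝ)).mpr hu
      push_cast at hu'
      linarith [hszle u.1, hszle v.1]
  have hrow : ∀ u : (Σ i : Fin k, Fin (sz i)),
      ∑ v : (Σ i : Fin k, Fin (sz i)),
        ((if v.1 = u.1 then A else B) - if u = v then A else 0) =
        (sz u.1 - 1) * A + (n - sz u.1) * B := by
    intro u
    have hc := Finset.card_filter_add_card_filter_not (s := Finset.univ)
      (fun w : (Σ i : Fin k, Fin (sz i)) => w.1 = u.1)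
    rw [Finset.card_univ, hcard, card_sigma_fst_eq] at hc
    have hc' := congrArg (Nat.cast (R := ℝ)) hc
    push_cast at hc'
    rw [Finset.sum_sub_distrib, Finset.sum_ite_eq, if_pos (Finset.mem_univ _), Finset.sum_ite,
      Finset.sum_const, Finset.sum_const, card_sigma_fst_eq, nsmul_eq_mul, nsmul_eq_mul,
      ← hc']
    ring
  have htotal : (∑ u : (Σ i : Fin k, Fin (sz i)), ∑ v : (Σ i : Fin k, Fin (sz i)),
      if u = v then 0 else
        q ^ (Finset.univ.filter fun w : (Σ i : Fin k, Fin (sz i)) =>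
          w.1 ≠ u.1 ∧ w.1 ≠ v.1).card) ≤ n * x * A + (n ^ 2 - n * x) * B := by
    refine (Finset.sum_le_sum fun u _ => Finset.sum_le_sum fun v _ => hterm u v).trans ?_
    rw [Finset.sum_congr rfl fun u _ => hrow u, Fintype.sum_sigma]
    simp only [Finset.sum_const, Finset.card_univ, Fintype.card_fin, nsmul_eq_mul]
    have hsq : (n : ℝ) * x ≤ ∑ i, (sz i : ℝ) ^ 2 := by
      have h := sq_sum_le_card_mul_sum_sq (s := Finset.univ) (f := fun i => (sz i : ℝ))
      rw [hsumR, Finset.card_univ, Fintype.card_fin] at h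
      rw [hx, ← mul_div_assoc, div_le_iff₀ hk0]
      linarith
    have hfst : ∑ i, (sz i : ℝ) * ((sz i - 1) * A) ≤ n * x * A := by
      rw [← hsumR, Finset.sum_mul, Finset.sum_mul]
      refine Finset.sum_le_sum fun i _ => ?_
      rw [← mul_assoc]
      gcongr
      linarith [hszle i]
    have hsnd : ∑ i, (sz i : ℝ) * ((n - sz i) * B) = (n ^ 2 - ∑ i, (sz i : ℝ) ^ 2) * B := by
      have : (n : ℝ) ^ 2 = ∑ i, (sz i : ℝ) * n := by rw [← Finset.sum_mul, hsumR, sq]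
      rw [this, ← Finset.sum_sub_distrib, Finset.sum_mul]
      exact Finset.sum_congr rfl fun i _ => by ring
    simp only [mul_add, Finset.sum_add_distrib]
    rw [hsnd]
    have := mul_le_mul_of_nonneg_right (sub_le_sub_left hsq ((n : ℝ) ^ 2)) hB0
    linarith
  rw [hα, ← hA]
  have hmain : (n : ℝ) ^ 2 * A / (2 * k) * (1 + (k - 1) * q ^ (-x - 1)) =
      (n * x * A + (n ^ 2 - n * x) * B) / 2 := by
    rw [hAB, hx]
    field_simp
  rw [hmain]
  have hfac : 0 ≤ n * x * A + ((n : ℝ) ^ 2 - n * x) * B := by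
    have : 0 ≤ (n : ℝ) ^ 2 - n * x := by rw [hnx]; nlinarith [mul_pos hk0 (by linarith : 0 < x)]
    have : 0 ≤ (n : ℝ) * x := mul_nonneg hn0.le (by linarith)
    positivity
  have hkn : 0 ≤ (k : ℝ) / n := by positivity
  nlinarith [mul_nonneg hfac hkn]
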